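/- Let p be an odd prime and let G be a UCS p-group. Then exactly one of the following holds: (i) G is abelian and is isomorphic to a direct power (C_{p²})^r of the cyclic group of order p² for some r ≥ 1; (ii) G is non-abelian of exponent p; (iii) G is non-abelian of exponent p², in which case G^p = G' = Φ(G) and |G| = |G/Φ(G)|², i.e., |G| = p^{2r} where p^r = |G/Φ(G)|. -/

import Mathlib

/-- A finite `p`-group is a UCS group if it has exactly three characteristic
subgroups. -/
def IsUCS (p : ℕ) (G : Type*) [Group G] : Prop :=
  IsPGroup p G ∧ Nat.card {H : Subgroup G // H.Characteristic} = 3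

/-- The subgroup `G^p` generated by all `p`-th powers. -/
def powSubgroup (p : ℕ) (G : Type*) [Group G] : Subgroup G :=
  Subgroup.closure {x : G | ∃ g : G, g ^ p = x}

open Subgroup
open scoped commutatorElement

namespace IsUCS

variable {p : ℕ} {G : Type*} [Group G]

lemma eq_of_characteristic [Finite G] (hG : IsUCS p G) {A B : Subgroup G}
    (hA : A.Characteristic) (hB : B.Characteristic) (hA₀ : A ≠ ⊥) (hA₁ : A ≠ ⊤)
    (hB₀ : B ≠ ⊥) (hB₁ : B ≠ ⊤) : A = B := by
  classical
  by_contra hAB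
  have : Fintype {H : Subgroup G // H.Characteristic} := Fintype.ofFinite _
  have hcard := hG.2
  rw [Nat.card_eq_fintype_card] at hcard
  have hbt : (⊥ : Subgroup G) ≠ ⊤ := by
    intro h
    exact hA₀ (le_antisymm (h ▸ le_top) bot_le)
  let s : Finset {H : Subgroup G // H.Characteristic} :=
    {⟨⊥, inferInstance⟩, ⟨⊤, inferInstance⟩, ⟨A, hA⟩, ⟨B, hB⟩}
  have hs : s.card = 4 := by
    simp [s, Finset.card_insert_of_notMem, hbt, hA₀.symm, hA₁.symm, hB₀.symm, hB₁.symm, hAB]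
  have := s.card_le_univ
  omega

lemma exists_characteristic (hG : IsUCS p G) :
    ∃ A : Subgroup G, A.Characteristic ∧ A ≠ ⊥ ∧ A ≠ ⊤ := by
  classical
  by_contra! h
  have hsub : (Set.univ : Set {H : Subgroup G // H.Characteristic}) ⊆
      ({⟨⊥, inferInstance⟩, ⟨⊤, inferInstance⟩} : Finset {H : Subgroup G // H.Characteristic}) := by
    rintro ⟨A, hA⟩ -
    by_cases h₀ : A = ⊥
    · simp [h₀]
    · simp [h A hA h₀]
  have h₁ := Set.ncard_le_ncard hsub (Finset.finite_toSet _)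
  rw [Set.ncard_univ, hG.2, Set.ncard_coe_finset] at h₁
  exact absurd (h₁.trans Finset.card_le_two) (by norm_num)

lemma nontrivial (hG : IsUCS p G) : Nontrivial G := by
  obtain ⟨A, -, h₀, -⟩ := hG.exists_characteristic
  obtain ⟨a, ha⟩ := A.ne_bot_iff_exists_ne_one.mp h₀
  exact ⟨⟨a, 1, fun h => ha (Subtype.ext h)⟩⟩

end IsUCS

lemma pow_mem_powSubgroup (p : ℕ) {G : Type*} [Group G] (g : G) : g ^ p ∈ powSubgroup p G :=
  subset_closure ⟨g, rfl⟩

lemma powSubgroup_characteristic (p : ℕ) (G : Type*) [Group G] :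
    (powSubgroup p G).Characteristic := by
  rw [characteristic_iff_le_comap]
  intro φ
  rw [powSubgroup, closure_le]
  rintro _ ⟨g, rfl⟩
  exact subset_closure ⟨φ g, (map_pow φ g p).symm⟩

lemma powSubgroup_eq_range {p : ℕ} {G : Type*} [Group G] (φ : G →* G) (hφ : ∀ x, φ x = x ^ p) :
    powSubgroup p G = φ.range := by
  apply le_antisymm
  · rw [powSubgroup, closure_le]
    rintro _ ⟨g, rfl⟩
    exact ⟨g, hφ g⟩
  · rintro _ ⟨g, rfl⟩
    rw [hφ]
    exact pow_mem_powSubgroup p g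

lemma ker_characteristic_of_eq_pow {p : ℕ} {G : Type*} [Group G] (φ : G →* G)
    (hφ : ∀ x, φ x = x ^ p) : φ.ker.Characteristic := by
  rw [characteristic_iff_le_comap]
  intro ψ x hx
  rw [MonoidHom.mem_ker, hφ] at hx
  simp [MonoidHom.mem_ker, hφ, ← map_pow, hx]

/-- A commutative group of prime exponent is characteristically simple. -/
lemma eq_bot_or_eq_top_of_characteristic_of_pow_eq_one {p : ℕ} (hp : p.Prime) {G : Type*}
    [CommGroup G] (hpow : ∀ x : G, x ^ p = 1) [Finite G] (A : Subgroup G)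
    (hA : A.Characteristic) : A = ⊥ ∨ A = ⊤ := by
  have := Fact.mk hp
  let _ : Module (ZMod p) (Additive G) :=
    AddCommGroup.zmodModule (n := p) fun x => hpow x.toMul
  by_contra! h
  obtain ⟨⟨a, haA⟩, ha⟩ := A.ne_bot_iff_exists_ne_one.mp h.1
  apply h.2
  rw [eq_top_iff]
  rintro b -
  by_cases hb : b = 1
  · rw [hb]; exact A.one_mem
  have ha' : Additive.ofMul a ≠ 0 := fun h => ha (Subtype.ext h)
  have hb' : Additive.ofMul b ≠ 0 := hb
  let f := (LinearEquiv.toSpanNonzeroSingleton (ZMod p) _ _ ha').symm ≪≫ₗ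
    LinearEquiv.toSpanNonzeroSingleton (ZMod p) _ _ hb'
  obtain ⟨g, hg⟩ := Submodule.exists_linearEquiv_restrict_eq f
  have hgab : g (Additive.ofMul a) = Additive.ofMul b := by
    have h₁ := hg ⟨Additive.ofMul a, Submodule.mem_span_singleton_self _⟩
    rw [← h₁]
    simp only [f, LinearEquiv.trans_apply]
    rw [← LinearEquiv.toSpanNonzeroSingleton_one (ZMod p) _ _ ha', LinearEquiv.symm_apply_apply]
    simp
  have h₂ := characteristic_iff_le_comap.mp hA (AddEquiv.toMultiplicative g.toAddEquiv) haA
  have h₃ : (AddEquiv.toMultiplicative g.toAddEquiv) a = b := hgab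
  rw [← h₃]
  exact h₂

section PGroup

variable {p : ℕ} [hp : Fact p.Prime] {G : Type*} [Group G] [Finite G]

lemma IsPGroup.normal_of_isCoatom (hG : IsPGroup p G) {M : Subgroup G} (hM : IsCoatom M) :
    M.Normal := by
  have := hG.isNilpotent
  exact Group.normalizerCondition_of_isNilpotent.normal_of_coatom M hM

lemma IsPGroup.index_of_isCoatom (hG : IsPGroup p G) {M : Subgroup G} (hM : IsCoatom M) :
    M.index = p := by
  obtain ⟨n, hn⟩ := IsPGroup.iff_card.mp hG
  obtain ⟨m, hm⟩ := IsPGroup.iff_card.mp (hG.to_subgroup M)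
  have hlt : m < n := by
    have h₁ : Nat.card M ≤ Nat.card G := Subgroup.card_le_card_group M
    have h₂ : Nat.card M ≠ Nat.card G := fun h => hM.1 (M.card_eq_iff_eq_top.mp h)
    have h₃ := lt_of_le_of_ne h₁ h₂
    rw [hn, hm] at h₃
    exact (Nat.pow_lt_pow_iff_right hp.out.one_lt).mp h₃
  obtain ⟨K, hK, hMK⟩ := Sylow.exists_subgroup_card_pow_succ (G := G) (p := p) (n := m)
    (hn ▸ pow_dvd_pow p hlt) hm
  have hlt' : M < K := by
    refine lt_of_le_of_ne hMK ?_
    rintro rfl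
    rw [hm] at hK
    exact absurd (Nat.pow_right_injective hp.out.two_le hK) (by omega)
  have hKtop := hM.2 K hlt'
  have h := M.card_mul_index
  rw [← Subgroup.card_top (G := G), ← hKtop, hK, hm, pow_succ] at h
  exact Nat.eq_of_mul_eq_mul_left (pow_pos hp.out.pos m) h

lemma IsPGroup.powSubgroup_le_frattini (hG : IsPGroup p G) : powSubgroup p G ≤ frattini G := by
  rw [powSubgroup, closure_le]
  rintro _ ⟨g, rfl⟩
  simp only [frattini, Order.radical, SetLike.mem_coe, mem_iInf]
  intro M hM
  have := hG.normal_of_isCoatom hM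
  rw [← hG.index_of_isCoatom hM]
  exact M.pow_index_mem g

lemma IsPGroup.commutator_le_frattini (hG : IsPGroup p G) : commutator G ≤ frattini G := by
  refine le_iInf₂ fun M hM => ?_
  have := hG.normal_of_isCoatom hM
  rw [← Subgroup.Normal.quotient_commutative_iff_commutator_le]
  have : IsCyclic (G ⧸ M) := isCyclic_of_prime_card (p := p) (hG.index_of_isCoatom hM)
  infer_instance

end PGroup

lemma frattini_ne_top (G : Type*) [Group G] [Finite G] [Nontrivial G] : frattini G ≠ ⊤ := by
  obtain ⟨M, hM, -⟩ := (eq_top_or_exists_le_coatom (⊥ : Subgroup G)).resolve_left bot_ne_top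
  intro h
  exact hM.1 (top_le_iff.mp (h ▸ frattini_le_coatom hM))

section Central

variable {G : Type*} [Group G]

lemma pow_mul_of_mul_eq_central {a b c : G} (hc : c ∈ center G) (h : a * b = c * b * a) (n : ℕ) :
    a ^ n * b = c ^ n * b * a ^ n := by
  induction n with
  | zero => simp
  | succ n ih =>
    have hcn : ∀ g, g * c ^ n = c ^ n * g := mem_center_iff.mp (pow_mem hc n)
    calc a ^ (n + 1) * b = a * (a ^ n * b) := by rw [pow_succ']; group
      _ = a * c ^ n * b * a ^ n := by rw [ih]; group
      _ = c ^ n * (a * b) * a ^ n := by rw [hcn]; group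
      _ = c ^ (n + 1) * b * a ^ (n + 1) := by rw [h, pow_succ c, pow_succ' a]; group

lemma mul_pow_of_mul_eq_central {a b c : G} (hc : c ∈ center G) (h : b * a = c * a * b) (n : ℕ) :
    (a * b) ^ n = c ^ (n.choose 2) * a ^ n * b ^ n := by
  induction n with
  | zero => simp
  | succ n ih =>
    have hcn : ∀ g, g * c ^ n = c ^ n * g := mem_center_iff.mp (pow_mem hc n)
    calc (a * b) ^ (n + 1) = c ^ (n.choose 2) * a ^ n * (b ^ n * a) * b := by
          rw [pow_succ, ih]; group
      _ = c ^ (n.choose 2) * (a ^ n * c ^ n) * a * b ^ n * b := by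
          rw [pow_mul_of_mul_eq_central hc h]; group
      _ = c ^ (n.choose 2 + n) * (a ^ n * a) * (b ^ n * b) := by rw [hcn, pow_add]; group
      _ = _ := by
          rw [← pow_succ, ← pow_succ, Nat.choose_succ_succ' n 1, Nat.choose_one_right, add_comm n (n.choose 2)]

/-- The subgroup of central elements killed by the `n`-th power. -/
def centerTorsion (n : ℕ) (G : Type*) [Group G] : Subgroup G where
  carrier := {x | x ∈ center G ∧ x ^ n = 1}
  one_mem' := ⟨one_mem _, one_pow n⟩
  mul_mem' {a b} ha hb := ⟨mul_mem ha.1 hb.1, by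
    have hab : Commute a b := (mem_center_iff.mp ha.1 b).symm
    rw [hab.mul_pow, ha.2, hb.2, one_mul]⟩
  inv_mem' {a} ha := ⟨inv_mem ha.1, by rw [inv_pow, ha.2, inv_one]⟩

lemma mem_centerTorsion {n : ℕ} {x : G} : x ∈ centerTorsion n G ↔ x ∈ center G ∧ x ^ n = 1 :=
  Iff.rfl

lemma centerTorsion_characteristic (n : ℕ) (G : Type*) [Group G] :
    (centerTorsion n G).Characteristic := by
  rw [characteristic_iff_le_comap]
  intro φ x hx
  refine ⟨characteristic_iff_le_comap.mp centerCharacteristic φ hx.1, ?_⟩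
  simp [← map_pow, hx.2]

end Central

namespace IsUCS

variable {p : ℕ} [hp : Fact p.Prime] {G : Type*} [Group G] [Finite G]

lemma commutator_ne_top (hG : IsUCS p G) : commutator G ≠ ⊤ := by
  have := hG.nontrivial
  exact fun h => frattini_ne_top G (top_le_iff.mp (h ▸ hG.1.commutator_le_frattini))

lemma powSubgroup_ne_top (hG : IsUCS p G) : powSubgroup p G ≠ ⊤ := by
  have := hG.nontrivial
  exact fun h => frattini_ne_top G (top_le_iff.mp (h ▸ hG.1.powSubgroup_le_frattini))

lemma ker_eq_range_of_eq_pow (hG : IsUCS p G) (φ : G →* G) (hφ : ∀ x, φ x = x ^ p)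
    (hpow : powSubgroup p G ≠ ⊥) : φ.ker = φ.range := by
  have := hG.nontrivial
  rw [← powSubgroup_eq_range φ hφ]
  refine hG.eq_of_characteristic (ker_characteristic_of_eq_pow φ hφ)
    (powSubgroup_characteristic p G) ?_ ?_ hpow hG.powSubgroup_ne_top
  · intro h
    have h₁ := (MonoidHom.ker_eq_bot_iff φ).mp h
    have h₂ := Finite.surjective_of_injective h₁
    exact hG.powSubgroup_ne_top
      ((powSubgroup_eq_range φ hφ).trans (MonoidHom.range_eq_top.mpr h₂))
  · intro h
    apply hpow
    rw [powSubgroup_eq_range φ hφ, eq_bot_iff]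
    rintro _ ⟨x, rfl⟩
    exact (h ▸ mem_top x : x ∈ φ.ker)

end IsUCS

lemma exists_mulEquiv_pi_zmod_sq {p : ℕ} (hp : p.Prime) {G : Type*} [CommGroup G] [Finite G]
    [Nontrivial G] (h : (powMonoidHom p : G →* G).ker = (powMonoidHom p : G →* G).range) :
    ∃ r : ℕ, 1 ≤ r ∧ Nonempty (G ≃* (Fin r → Multiplicative (ZMod (p ^ 2)))) := by
  classical
  obtain ⟨ι, _, n, hn, ⟨e⟩⟩ := CommGroup.equiv_prod_multiplicative_zmod_of_finite G
  have hsq (x : G) : x ^ p ^ 2 = 1 := by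
    have : x ^ p ∈ (powMonoidHom p : G →* G).ker := h ▸ ⟨x, rfl⟩
    rw [pow_two, pow_mul]
    exact this
  have horder (i : ι) (k : ℕ) :
      e.symm (Pi.mulSingle i (Multiplicative.ofAdd 1)) ^ k = 1 ↔ n i ∣ k := by
    rw [← map_pow, ← Pi.mulSingle_pow, EmbeddingLike.map_eq_one_iff, Pi.mulSingle_eq_one_iff,
      ← ofAdd_nsmul, ofAdd_eq_one, nsmul_one, ZMod.natCast_eq_zero_iff]
  have hnp : n = fun _ => p ^ 2 := by
    funext i
    obtain ⟨k, hk, hk'⟩ := (Nat.dvd_prime_pow hp).mp ((horder i (p ^ 2)).mp (hsq _))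
    interval_cases k
    · exact absurd (hn i) (by simp [hk'])
    · rw [pow_one] at hk'
      have h₁ : e.symm (Pi.mulSingle i (Multiplicative.ofAdd 1)) ∈ (powMonoidHom p : G →* G).ker :=
        (horder i p).mpr hk'.dvd
      rw [h] at h₁
      obtain ⟨y, hy⟩ := h₁
      have h₂ := congrFun (congrArg e hy) i
      rw [powMonoidHom_apply, map_pow, Pi.pow_apply, MulEquiv.apply_symm_apply,
        Pi.mulSingle_eq_same] at h₂
      have h₃ : (e y i) ^ p = 1 := by
        rw [← toAdd_eq_zero, toAdd_pow, nsmul_eq_mul,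
          (ZMod.natCast_eq_zero_iff p (n i)).mpr hk'.dvd, zero_mul]
      have h₄ := (horder i 1).mp (by rw [pow_one, ← h₂, h₃]; simp)
      have := hn i
      have := Nat.dvd_one.mp h₄
      omega
    · exact hk'
  subst hnp
  let e' : (ι → Multiplicative (ZMod (p ^ 2))) ≃*
      (Fin (Fintype.card ι) → Multiplicative (ZMod (p ^ 2))) :=
    MulEquiv.arrowCongr (Fintype.equivFin ι) (MulEquiv.refl _)
  refine ⟨Fintype.card ι, ?_, ⟨e.trans e'⟩⟩
  by_contra hcard
  have : IsEmpty ι := Fintype.card_eq_zero_iff.mp (by omega)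
  exact not_subsingleton G e.toEquiv.subsingleton

namespace IsUCS

variable {p : ℕ} [hp : Fact p.Prime] {G : Type*}

lemma powSubgroup_ne_bot_of_comm [CommGroup G] [Finite G] (hG : IsUCS p G) :
    powSubgroup p G ≠ ⊥ := by
  intro h
  obtain ⟨A, hA, h₀, h₁⟩ := hG.exists_characteristic
  have hpow (x : G) : x ^ p = 1 := by
    have := pow_mem_powSubgroup p x
    rwa [h, mem_bot] at this
  exact (eq_bot_or_eq_top_of_characteristic_of_pow_eq_one hp.out hpow A hA).elim h₀ h₁

lemma exists_mulEquiv_of_comm [CommGroup G] [Finite G] (hG : IsUCS p G) :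
    ∃ r : ℕ, 1 ≤ r ∧ Nonempty (G ≃* (Fin r → Multiplicative (ZMod (p ^ 2)))) := by
  have := hG.nontrivial
  exact exists_mulEquiv_pi_zmod_sq hp.out
    (hG.ker_eq_range_of_eq_pow _ (fun _ => rfl) hG.powSubgroup_ne_bot_of_comm)

variable [Group G] [Finite G]

lemma commutator_eq_frattini (hG : IsUCS p G) (hab : commutator G ≠ ⊥) :
    commutator G = frattini G := by
  have := hG.nontrivial
  refine hG.eq_of_characteristic inferInstance inferInstance hab hG.commutator_ne_top ?_
    (frattini_ne_top G)
  intro h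
  exact hab (le_bot_iff.mp (h ▸ hG.1.commutator_le_frattini))

lemma commutator_eq_center (hG : IsUCS p G) (hab : commutator G ≠ ⊥) :
    commutator G = center G := by
  have := hG.nontrivial
  refine hG.eq_of_characteristic inferInstance inferInstance hab hG.commutator_ne_top
    hG.1.bot_lt_center.ne' ?_
  rwa [Ne, ← commutator_eq_bot_iff_center_eq_top]

lemma powSubgroup_le_center (hG : IsUCS p G) (hab : commutator G ≠ ⊥) :
    powSubgroup p G ≤ center G := by
  rw [← hG.commutator_eq_center hab, hG.commutator_eq_frattini hab]
  exact hG.1.powSubgroup_le_frattini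

lemma commutatorElement_mem_centerTorsion (hG : IsUCS p G) (hab : commutator G ≠ ⊥) (a b : G) :
    ⁅a, b⁆ ∈ centerTorsion p G := by
  have hc : ⁅a, b⁆ ∈ center G := by
    rw [← hG.commutator_eq_center hab]
    exact commutator_mem_commutator (mem_top a) (mem_top b)
  refine ⟨hc, ?_⟩
  have h₁ := pow_mul_of_mul_eq_central (a := a) (b := b) hc
    (by rw [commutatorElement_def]; group) p
  have h₂ := mem_center_iff.mp (hG.powSubgroup_le_center hab (pow_mem_powSubgroup p a)) b
  rw [← h₂, mul_assoc] at h₁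
  exact (right_eq_mul.mp h₁)

lemma mul_pow (hG : IsUCS p G) (hodd : Odd p) (hab : commutator G ≠ ⊥) (a b : G) :
    (a * b) ^ p = a ^ p * b ^ p := by
  obtain ⟨hc, hcp⟩ := hG.commutatorElement_mem_centerTorsion hab b a
  rw [mul_pow_of_mul_eq_central hc (by rw [commutatorElement_def]; group)]
  have hp2 : 2 < p := lt_of_le_of_ne hp.out.two_le fun h => by
    rw [← h] at hodd; exact absurd hodd (by decide)
  obtain ⟨k, hk⟩ := hp.out.dvd_choose_self two_ne_zero hp2
  rw [hk, pow_mul, hcp, one_pow, one_mul]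

lemma exponent_eq_or (hG : IsUCS p G) (hodd : Odd p) (hab : commutator G ≠ ⊥) :
    Monoid.exponent G = p ∨ Monoid.exponent G = p ^ 2 ∧
        powSubgroup p G = commutator G ∧ commutator G = frattini G ∧
        Nat.card G = (Nat.card (G ⧸ frattini G)) ^ 2 := by
  have := hG.nontrivial
  let φ : G →* G := MonoidHom.mk' (fun x => x ^ p) (hG.mul_pow hodd hab)
  have hφ (x : G) : φ x = x ^ p := rfl
  by_cases hpow : powSubgroup p G = ⊥
  · left
    refine (Nat.dvd_prime hp.out).mp (Monoid.exponent_dvd_iff_forall_pow_eq_one.mpr fun g => ?_)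
      |>.resolve_left ?_
    · have := pow_mem_powSubgroup p g
      rwa [hpow, mem_bot] at this
    · rw [Monoid.exp_eq_one_iff]
      exact not_subsingleton G
  · right
    have hker := hG.ker_eq_range_of_eq_pow φ hφ hpow
    have hrange := powSubgroup_eq_range φ hφ
    have hpc : powSubgroup p G = commutator G :=
      hG.eq_of_characteristic (powSubgroup_characteristic p G) inferInstance hpow
        hG.powSubgroup_ne_top hab hG.commutator_ne_top
    have hcf := hG.commutator_eq_frattini hab
    have hnot : ¬ Monoid.exponent G ∣ p ^ 1 := by
      rw [pow_one, Monoid.exponent_dvd_iff_forall_pow_eq_one]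
      intro h
      apply hpow
      rw [hrange, eq_bot_iff]
      rintro _ ⟨x, rfl⟩
      exact h x
    refine ⟨?_, hpc, hcf, ?_⟩
    · refine Nat.eq_prime_pow_of_dvd_least_prime_pow hp.out hnot
        (Monoid.exponent_dvd_iff_forall_pow_eq_one.mpr fun g => ?_)
      have h₁ : φ g ∈ φ.ker := hker ▸ ⟨g, rfl⟩
      rw [pow_succ, pow_one, pow_mul]
      exact h₁
    · have h₁ : Nat.card (G ⧸ frattini G) = Nat.card (frattini G) := by
        rw [← hcf, ← hpc, hrange]
        conv_lhs => rw [← hker]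
        exact Nat.card_congr (QuotientGroup.quotientKerEquivRange φ).toEquiv
      rw [(frattini G).card_eq_card_quotient_mul_card_subgroup, ← h₁, pow_two]

end IsUCS

theorem stmt2 (p : ℕ) (hp : p.Prime) (hodd : Odd p)
    (G : Type*) [Group G] [Finite G] (hG : IsUCS p G) :
    ((∀ a b : G, a * b = b * a) ∧
        ∃ r : ℕ, 1 ≤ r ∧ Nonempty (G ≃* (Fin r → Multiplicative (ZMod (p ^ 2)))))
    ∨ (¬ (∀ a b : G, a * b = b * a) ∧ Monoid.exponent G = p)
    ∨ (¬ (∀ a b : G, a * b = b * a) ∧ Monoid.exponent G = p ^ 2 ∧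
        powSubgroup p G = commutator G ∧ commutator G = frattini G ∧
        Nat.card G = (Nat.card (G ⧸ frattini G)) ^ 2) := by
  have := Fact.mk hp
  by_cases hcomm : ∀ a b : G, a * b = b * a
  · left
    let _ : CommGroup G := { ‹Group G› with mul_comm := hcomm }
    exact ⟨hcomm, hG.exists_mulEquiv_of_comm⟩
  · right
    have hab : commutator G ≠ ⊥ := by
      rw [Ne, commutator_eq_bot_iff_center_eq_top]
      intro h
      exact hcomm fun a b => mem_center_iff.mp (h ▸ mem_top b) a
    exact (hG.exponent_eq_or hodd hab).imp (⟨hcomm, ·⟩) (⟨hcomm, ·⟩)
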